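/- arXiv:2306.05300 — 6 statements merged into one kernel-verified Lean document; each statement's English description precedes it below -/
import Mathlib

section
/- Let d, M, S be positive integers with M ≥ 2, set N := M·S, and let u₁,…,u_N ∈ ℝᵈ satisfy ∑ₙ uₙ = 0. Let π₀ and π₁ be independent, uniformly distributed random permutations of {1,…,N}. For 0 ≤ j < M set B_j := {π₀(jS+1),…,π₀(jS+S)} and B_{M+j} := {π₁(jS+1),…,π₁(jS+S)}, and define the noise terms δg_k := (1/S)·∑_{n∈B_k} uₙ for 0 ≤ k < 2M. Let C := E[δg₀·δg₀ᵀ]. Then for every integer h with 0 ≤ h ≤ M, the epoch-averaged autocorrelation satisfies (1/M)·∑_{j=0}^{M−1} E[δg_j·δg_{j+h}ᵀ] = C·(δ_{h,0} − 𝟙_{1≤h≤M}·(M−h)/(M(M−1))), where δ_{h,0} is the Kronecker delta and 𝟙 the indicator. -/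
open Finset Matrix

lemma blk_G_symm {M S N : ℕ} (e : Fin M × Fin S ≃ Fin N) (f g : Fin N → ℝ)
    (τ : Equiv.Perm (Fin M)) (j k : Fin M) :
    ∑ σ : Equiv.Perm (Fin N), (∑ i, f (σ (e (τ j, i)))) * (∑ i, g (σ (e (τ k, i)))) =
    ∑ σ : Equiv.Perm (Fin N), (∑ i, f (σ (e (j, i)))) * (∑ i, g (σ (e (k, i)))) := by
  let ρ : Equiv.Perm (Fin N) :=
    (e.symm.trans (τ.prodCongr (Equiv.refl (Fin S)))).trans e
  rw [← Equiv.sum_comp (Equiv.mulRight ρ)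
    (fun σ : Equiv.Perm (Fin N) => (∑ i, f (σ (e (j, i)))) * (∑ i, g (σ (e (k, i)))))]
  simp [ρ]

lemma blk_one_symm {M S N : ℕ} (e : Fin M × Fin S ≃ Fin N) (f : Fin N → ℝ)
    (τ : Equiv.Perm (Fin M)) (j : Fin M) :
    ∑ σ : Equiv.Perm (Fin N), (∑ i, f (σ (e (τ j, i)))) =
    ∑ σ : Equiv.Perm (Fin N), (∑ i, f (σ (e (j, i)))) := by
  let ρ : Equiv.Perm (Fin N) :=
    (e.symm.trans (τ.prodCongr (Equiv.refl (Fin S)))).trans e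
  rw [← Equiv.sum_comp (Equiv.mulRight ρ)
    (fun σ : Equiv.Perm (Fin N) => (∑ i, f (σ (e (j, i)))))]
  simp [ρ]

lemma blk_total {M S N : ℕ} (e : Fin M × Fin S ≃ Fin N) (f : Fin N → ℝ) (hf : ∑ n, f n = 0)
    (σ : Equiv.Perm (Fin N)) : ∑ k, ∑ i, f (σ (e (k, i))) = 0 := by
  rw [← Fintype.sum_prod_type' (fun k i => f (σ (e (k, i))))]
  rw [← hf, ← Equiv.sum_comp (e.trans σ) f]
  rfl

lemma blk_one_zero {M S N : ℕ} (e : Fin M × Fin S ≃ Fin N) (f : Fin N → ℝ) (hf : ∑ n, f n = 0)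
    (j : Fin M) : ∑ σ : Equiv.Perm (Fin N), (∑ i, f (σ (e (j, i)))) = 0 := by
  have h1 : ∑ k : Fin M, ∑ σ : Equiv.Perm (Fin N), (∑ i, f (σ (e (k, i)))) = 0 := by
    rw [Finset.sum_comm]
    exact Finset.sum_eq_zero fun σ _ => blk_total e f hf σ
  have h2 : ∀ k : Fin M, ∑ σ : Equiv.Perm (Fin N), (∑ i, f (σ (e (k, i)))) =
      ∑ σ : Equiv.Perm (Fin N), (∑ i, f (σ (e (j, i)))) := fun k => by
    have := blk_one_symm e f (Equiv.swap j k) j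
    rwa [Equiv.swap_apply_left] at this
  simp only [h2, Finset.sum_const, Finset.card_univ, Fintype.card_fin, nsmul_eq_mul] at h1
  have : (M : ℝ) ≠ 0 := by
    have := j.pos
    positivity
  exact (mul_eq_zero.mp h1).resolve_left this

lemma blk_diag {M S N : ℕ} (e : Fin M × Fin S ≃ Fin N) (f g : Fin N → ℝ) (j k : Fin M) :
    ∑ σ : Equiv.Perm (Fin N), (∑ i, f (σ (e (j, i)))) * (∑ i, g (σ (e (j, i)))) =
    ∑ σ : Equiv.Perm (Fin N), (∑ i, f (σ (e (k, i)))) * (∑ i, g (σ (e (k, i)))) := by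
  have := blk_G_symm e f g (Equiv.swap k j) k k
  rwa [Equiv.swap_apply_left] at this

lemma blk_off {M S N : ℕ} (e : Fin M × Fin S ≃ Fin N) (f g : Fin N → ℝ) (hg : ∑ n, g n = 0)
    (j k : Fin M) (hjk : j ≠ k) :
    ((M : ℝ) - 1) *
      ∑ σ : Equiv.Perm (Fin N), (∑ i, f (σ (e (j, i)))) * (∑ i, g (σ (e (k, i)))) =
    - ∑ σ : Equiv.Perm (Fin N), (∑ i, f (σ (e (j, i)))) * (∑ i, g (σ (e (j, i)))) := by
  have h1 : ∑ l : Fin M,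
      ∑ σ : Equiv.Perm (Fin N), (∑ i, f (σ (e (j, i)))) * (∑ i, g (σ (e (l, i)))) = 0 := by
    rw [Finset.sum_comm]
    refine Finset.sum_eq_zero fun σ _ => ?_
    rw [← Finset.mul_sum, blk_total e g hg σ, mul_zero]
  rw [← Finset.add_sum_erase _ _ (Finset.mem_univ j)] at h1
  have h2 : ∀ l ∈ Finset.univ.erase j,
      ∑ σ : Equiv.Perm (Fin N), (∑ i, f (σ (e (j, i)))) * (∑ i, g (σ (e (l, i)))) =
      ∑ σ : Equiv.Perm (Fin N), (∑ i, f (σ (e (j, i)))) * (∑ i, g (σ (e (k, i)))) := by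
    intro l hl
    have hl' : l ≠ j := Finset.ne_of_mem_erase hl
    have := blk_G_symm e f g (Equiv.swap k l) j k
    rwa [Equiv.swap_apply_left, Equiv.swap_apply_of_ne_of_ne hjk hl'.symm] at this
  rw [Finset.sum_congr rfl h2, Finset.sum_const, Finset.card_erase_of_mem (Finset.mem_univ j),
    Finset.card_univ, Fintype.card_fin, nsmul_eq_mul, Nat.cast_sub j.pos, Nat.cast_one] at h1
  linarith

/-- Theorem 1 of the paper: autocorrelation of epoch-based SGD noise at a fixed
weight vector, averaged over the position within the epoch.  Two independent
uniform random permutations `p.1`, `p.2` generate two consecutive epochs, each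
split into `M` consecutive batches of size `S`. -/
theorem epoch_sgd_noise_autocorrelation
    (d M S N : ℕ) (hd : 0 < d) (hS : 0 < S) (hM : 2 ≤ M) (hN : N = M * S)
    (u : Fin N → Fin d → ℝ) (hu : ∑ n, u n = 0)
    (idx : ℕ → Fin N) (hidx : ∀ t, t < N → (idx t : ℕ) = t)
    (dg : Equiv.Perm (Fin N) × Equiv.Perm (Fin N) → ℕ → Fin d → ℝ)
    (hdg0 : ∀ p k, k < M →
      dg p k = (S : ℝ)⁻¹ • ∑ i ∈ Finset.range S, u (p.1 (idx (k * S + i))))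
    (hdg1 : ∀ p k, M ≤ k → k < 2 * M →
      dg p k = (S : ℝ)⁻¹ • ∑ i ∈ Finset.range S, u (p.2 (idx ((k - M) * S + i))))
    (E : (Equiv.Perm (Fin N) × Equiv.Perm (Fin N) → Matrix (Fin d) (Fin d) ℝ) →
      Matrix (Fin d) (Fin d) ℝ)
    (hE : ∀ f, E f = (Fintype.card (Equiv.Perm (Fin N) × Equiv.Perm (Fin N)) : ℝ)⁻¹ •
      ∑ p : Equiv.Perm (Fin N) × Equiv.Perm (Fin N), f p)
    (C : Matrix (Fin d) (Fin d) ℝ)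
    (hC : C = E (fun p => vecMulVec (dg p 0) (dg p 0)))
    (h : ℕ) (hh : h ≤ M) :
    (M : ℝ)⁻¹ • ∑ j ∈ Finset.range M, E (fun p => vecMulVec (dg p j) (dg p (j + h))) =
      ((if h = 0 then (1 : ℝ) else 0) -
        (if 1 ≤ h ∧ h ≤ M then ((M : ℝ) - (h : ℝ)) / ((M : ℝ) * ((M : ℝ) - 1)) else 0)) • C := by
  subst hN
  have hM0 : 0 < M := by omega
  have hMr : (M : ℝ) - 1 ≠ 0 := by
    have : (2 : ℝ) ≤ M := by exact_mod_cast hM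
    linarith
  have hMr0 : (M : ℝ) ≠ 0 := by positivity
  let e : Fin M × Fin S ≃ Fin (M * S) := finProdFinEquiv
  have hidx' : ∀ (k : Fin M) (i : Fin S), idx ((k : ℕ) * S + (i : ℕ)) = e (k, i) := by
    intro k i
    have hlt : (k : ℕ) * S + (i : ℕ) < M * S := by
      have h1 := k.isLt
      have h2 := i.isLt
      calc (k : ℕ) * S + (i : ℕ) < (k : ℕ) * S + S := by omega
        _ = ((k : ℕ) + 1) * S := by ring
        _ ≤ M * S := Nat.mul_le_mul_right _ h1
    apply Fin.ext
    rw [hidx _ hlt]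
    simp [e, finProdFinEquiv]
    ring
  have hg0 : ∀ p (k : ℕ) (hk : k < M) a,
      dg p k a = (S : ℝ)⁻¹ * ∑ i, u (p.1 (e (⟨k, hk⟩, i))) a := by
    intro p k hk a
    rw [hdg0 p k hk, Finset.sum_range]
    simp only [Pi.smul_apply, Finset.sum_apply, smul_eq_mul]
    congr 1
    refine Finset.sum_congr rfl fun i _ => ?_
    rw [← hidx' ⟨k, hk⟩ i]
  have hg1 : ∀ p (k : ℕ) (hk : M ≤ k) (hk2 : k - M < M) a,
      dg p k a = (S : ℝ)⁻¹ * ∑ i, u (p.2 (e (⟨k - M, hk2⟩, i))) a := by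
    intro p k hk hk2 a
    rw [hdg1 p k hk (by omega), Finset.sum_range]
    simp only [Pi.smul_apply, Finset.sum_apply, smul_eq_mul]
    congr 1
    refine Finset.sum_congr rfl fun i _ => ?_
    rw [← hidx' ⟨k - M, hk2⟩ i]
  have hu' : ∀ a, ∑ n, u n a = 0 := by
    intro a
    have := congrFun hu a
    simpa using this
  have key : ∀ j ∈ Finset.range M, E (fun p => vecMulVec (dg p j) (dg p (j + h))) =
      (if h = 0 then (1 : ℝ) else if j < M - h then -((M : ℝ) - 1)⁻¹ else 0) • C := by
    intro j hj
    have hj : j < M := Finset.mem_range.mp hj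
    rw [hC, hE, hE]
    ext a b
    simp only [Matrix.smul_apply, Matrix.sum_apply, vecMulVec_apply, smul_eq_mul]
    rw [mul_left_comm]
    congr 1
    by_cases hlt : j + h < M
    · simp only [hg0 _ _ hj, hg0 _ _ hlt, hg0 _ _ hM0]
      simp only [mul_mul_mul_comm, ← Finset.mul_sum]
      rw [mul_left_comm]
      congr 1
      rw [Fintype.sum_prod_type, Fintype.sum_prod_type]
      simp only [Finset.sum_const, nsmul_eq_mul, ← Finset.mul_sum]
      rw [mul_left_comm]
      congr 1
      rw [blk_diag e (fun n => u n a) (fun n => u n b) ⟨0, hM0⟩ ⟨j, hj⟩]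
      by_cases h0 : h = 0
      · subst h0
        simp
      · have hne : (⟨j, hj⟩ : Fin M) ≠ ⟨j + h, hlt⟩ := by
          intro hc
          have := congrArg Fin.val hc
          simp at this
          omega
        have := blk_off e (fun n => u n a) (fun n => u n b) (hu' b) _ _ hne
        rw [if_neg h0, if_pos (by omega), neg_mul, ← mul_neg, ← this,
          inv_mul_cancel_left₀ hMr]
    · have h0 : h ≠ 0 := by omega
      rw [if_neg h0, if_neg (by omega), zero_mul]
      simp only [hg0 _ _ hj, hg1 _ (j + h) (by omega) (by omega)]
      simp only [mul_mul_mul_comm, ← Finset.mul_sum]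
      rw [Fintype.sum_prod_type]
      simp only [← Finset.mul_sum]
      rw [← Finset.sum_mul, blk_one_zero e (fun n => u n a) (hu' a), zero_mul, mul_zero]
  rw [Finset.sum_congr rfl key, ← Finset.sum_smul, smul_smul]
  congr 1
  by_cases h0 : h = 0
  · subst h0
    simp [hMr0]
  · have hf : (Finset.range M).filter (fun j => j < M - h) = Finset.range (M - h) := by
      ext j
      simp
      omega
    simp only [if_neg h0]
    rw [← Finset.sum_filter, hf, if_pos ⟨by omega, hh⟩, Finset.sum_const, Finset.card_range,
      nsmul_eq_mul, Nat.cast_sub hh]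
    field_simp
    ring
end

section
/- Let d, M, S be positive integers with M ≥ 2, set N := M·S (so N ≥ 2), and let u₁,…,u_N ∈ ℝᵈ satisfy ∑ₙ uₙ = 0. Let π be a uniformly distributed random permutation of {1,…,N}, let B_j := {π(jS+1),…,π(jS+S)} for 0 ≤ j < M, and set δg_j := (1/S)·∑_{n∈B_j} uₙ. Then for all 0 ≤ i < j < M, E[δg_i·δg_jᵀ] = −(1/(M−1))·(1/S − 1/N)·C₀, where C₀ := (1/(N−1))·∑_{n=1}^{N} uₙ·uₙᵀ. -/
open Finset Matrix

lemma perm_sum_diag {N : ℕ} (h : Fin N → ℝ) (b : Fin N) :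
    (N : ℝ) * ∑ π : Equiv.Perm (Fin N), h (π b) =
      (Fintype.card (Equiv.Perm (Fin N)) : ℝ) * ∑ n, h n := by
  have h1 : ∀ c : Fin N, ∑ π : Equiv.Perm (Fin N), h (π c) =
      ∑ π : Equiv.Perm (Fin N), h (π b) := by
    intro c
    refine Fintype.sum_equiv (Equiv.mulRight (Equiv.swap b c)) _ _ ?_
    intro π
    simp
  have h2 : ∑ c : Fin N, ∑ π : Equiv.Perm (Fin N), h (π c) =
      ∑ π : Equiv.Perm (Fin N), ∑ n, h n := by
    rw [Finset.sum_comm]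
    exact Finset.sum_congr rfl fun π _ => Equiv.sum_comp π h
  rw [Finset.sum_congr rfl fun c _ => h1 c] at h2
  simpa only [Finset.sum_const, Finset.card_univ, Fintype.card_fin, nsmul_eq_mul] using h2

lemma perm_sum_offdiag {N : ℕ} (f g : Fin N → ℝ) (hf : ∑ n, f n = 0) (a b : Fin N)
    (hab : a ≠ b) :
    ((N : ℝ) - 1) * ∑ π : Equiv.Perm (Fin N), f (π a) * g (π b) =
      - ∑ π : Equiv.Perm (Fin N), f (π b) * g (π b) := by
  have h1 : ∀ c ∈ Finset.univ.erase b, ∑ π : Equiv.Perm (Fin N), f (π c) * g (π b) =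
      ∑ π : Equiv.Perm (Fin N), f (π a) * g (π b) := by
    intro c hc
    have hcb : c ≠ b := Finset.ne_of_mem_erase hc
    refine Fintype.sum_equiv (Equiv.mulRight (Equiv.swap a c)) _ _ ?_
    intro π
    simp [Equiv.swap_apply_of_ne_of_ne hab.symm hcb.symm]
  have h2 : ∑ c : Fin N, ∑ π : Equiv.Perm (Fin N), f (π c) * g (π b) = 0 := by
    rw [Finset.sum_comm]
    refine Finset.sum_eq_zero fun π _ => ?_
    rw [← Finset.sum_mul, Equiv.sum_comp π f, hf, zero_mul]
  rw [← Finset.sum_erase_add _ _ (Finset.mem_univ b), Finset.sum_congr rfl h1,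
    Finset.sum_const, Finset.card_erase_of_mem (Finset.mem_univ b), Finset.card_univ,
    Fintype.card_fin, nsmul_eq_mul, Nat.cast_sub (Nat.one_le_iff_ne_zero.2 (by
      rintro rfl; exact a.elim0)), Nat.cast_one] at h2
  linarith

/-- Covariance of the noise of two distinct batches within the same training epoch:
a uniformly random permutation of the `N = M·S` examples is split into `M`
consecutive batches of size `S`. -/
theorem within_epoch_batch_anticorrelation
    (d M S N : ℕ) (hd : 0 < d) (hS : 0 < S) (hM : 2 ≤ M) (hN : N = M * S)
    (u : Fin N → Fin d → ℝ) (hu : ∑ n, u n = 0)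
    (idx : ℕ → Fin N) (hidx : ∀ t, t < N → (idx t : ℕ) = t)
    (dg : Equiv.Perm (Fin N) → ℕ → Fin d → ℝ)
    (hdg : ∀ π k, k < M →
      dg π k = (S : ℝ)⁻¹ • ∑ i ∈ Finset.range S, u (π (idx (k * S + i))))
    (E : (Equiv.Perm (Fin N) → Matrix (Fin d) (Fin d) ℝ) → Matrix (Fin d) (Fin d) ℝ)
    (hE : ∀ f, E f = (Fintype.card (Equiv.Perm (Fin N)) : ℝ)⁻¹ •
      ∑ π : Equiv.Perm (Fin N), f π)
    (C₀ : Matrix (Fin d) (Fin d) ℝ)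
    (hC₀ : C₀ = ((N : ℝ) - 1)⁻¹ • ∑ n, vecMulVec (u n) (u n))
    (i j : ℕ) (hij : i < j) (hjM : j < M) :
    E (fun π => vecMulVec (dg π i) (dg π j)) =
      (-(((M : ℝ) - 1)⁻¹) * ((S : ℝ)⁻¹ - (N : ℝ)⁻¹)) • C₀ := by
  have hM' : (2 : ℝ) ≤ M := by exact_mod_cast hM
  have hS' : (1 : ℝ) ≤ S := by exact_mod_cast hS
  have hNr : (N : ℝ) = M * S := by rw [hN]; push_cast; ring
  have hN2 : (2 : ℝ) ≤ N := by rw [hNr]; nlinarith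
  have hlt : ∀ k s, k < M → s < S → k * S + s < N := by
    intro k s hk hs
    rw [hN]
    nlinarith
  have hne : ∀ s ∈ Finset.range S, ∀ t ∈ Finset.range S,
      idx (i * S + s) ≠ idx (j * S + t) := by
    intro s hs t ht h
    rw [Finset.mem_range] at hs ht
    have h' := congrArg Fin.val h
    rw [hidx _ (hlt i s (hij.trans hjM) hs), hidx _ (hlt j t hjM ht)] at h'
    nlinarith
  set K : ℝ := (Fintype.card (Equiv.Perm (Fin N)) : ℝ) with hK
  have hK0 : K ≠ 0 := by
    rw [hK]
    exact_mod_cast Fintype.card_ne_zero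
  rw [hE, hC₀]
  ext p q
  have hup : ∑ n, u n p = 0 := by
    have := congrFun hu p
    simpa using this
  have key : ∀ s ∈ Finset.range S, ∀ t ∈ Finset.range S,
      ∑ π : Equiv.Perm (Fin N), u (π (idx (i * S + s))) p * u (π (idx (j * S + t))) q =
        -(K / (N * (N - 1)) * ∑ n, u n p * u n q) := by
    intro s hs t ht
    have e1 := perm_sum_offdiag (fun n => u n p) (fun n => u n q) hup _ _ (hne s hs t ht)
    have e2 := perm_sum_diag (fun n => u n p * u n q) (idx (j * S + t))
    have n0 : (N : ℝ) ≠ 0 := by linarith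
    have n1 : (N : ℝ) - 1 ≠ 0 := by linarith
    have e3 : (N : ℝ) * (((N : ℝ) - 1) * ∑ π : Equiv.Perm (Fin N),
        u (π (idx (i * S + s))) p * u (π (idx (j * S + t))) q) =
        -(K * ∑ n, u n p * u n q) := by
      rw [e1, mul_neg, e2]
    field_simp
    linarith
  have main : ∑ π : Equiv.Perm (Fin N), dg π i p * dg π j q =
      -(K / (N * (N - 1)) * ∑ n, u n p * u n q) := by
    have e : ∀ π : Equiv.Perm (Fin N), dg π i p * dg π j q = (S : ℝ)⁻¹ * (S : ℝ)⁻¹ *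
        ∑ s ∈ Finset.range S, ∑ t ∈ Finset.range S,
          u (π (idx (i * S + s))) p * u (π (idx (j * S + t))) q := by
      intro π
      rw [hdg π i (hij.trans hjM), hdg π j hjM, ← Finset.sum_mul_sum]
      simp only [Pi.smul_apply, Finset.sum_apply, smul_eq_mul]
      ring
    rw [Finset.sum_congr rfl fun π _ => e π, ← Finset.mul_sum, Finset.sum_comm]
    rw [Finset.sum_congr rfl fun s hs => (Finset.sum_comm.trans
      (Finset.sum_congr rfl fun t ht => key s hs t ht))]
    simp only [Finset.sum_const, Finset.card_range, nsmul_eq_mul]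
    have s0 : (S : ℝ) ≠ 0 := by linarith
    field_simp
  simp only [Matrix.smul_apply, Matrix.sum_apply, vecMulVec_apply, smul_eq_mul]
  rw [main]
  have c : -(((M : ℝ) - 1)⁻¹) * ((S : ℝ)⁻¹ - (N : ℝ)⁻¹) = -(N : ℝ)⁻¹ := by
    have s0 : (S : ℝ) ≠ 0 := by linarith
    have m0 : (M : ℝ) ≠ 0 := by linarith
    have m1 : (M : ℝ) - 1 ≠ 0 := by linarith
    rw [hNr]
    field_simp
  rw [c]
  have n0 : (N : ℝ) ≠ 0 := by linarith
  have n1 : (N : ℝ) - 1 ≠ 0 := by linarith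
  field_simp
end

section
/- Let η, λ, β be reals with η > 0, λ > 0, 0 ≤ β < 1 and 0 < ηλ < 2(1+β), let D := [[1+β−ηλ, −β],[1, 0]] and e₁ := (1,0)ᵀ. Then for every positive integer M, both entries of the vector D^M·e₁ have absolute value at most M+1; that is, ‖D^M·e₁‖_∞ ≤ M+1. -/
open Matrix

lemma root_norm_le (t β : ℝ) (hβ0 : 0 ≤ β) (hβ1 : β < 1) (ht : |t| < 1 + β) (z : ℂ)
    (hz : z * z - t * z + β = 0) : ‖z‖ ≤ 1 := by
  obtain ⟨ht1, ht2⟩ := abs_lt.mp ht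
  have hre := congrArg Complex.re hz
  have him := congrArg Complex.im hz
  simp at hre him
  have hsq : ‖z‖ ^ 2 = z.re * z.re + z.im * z.im := by
    rw [Complex.sq_norm, Complex.normSq_apply]
  have key : z.re * z.re + z.im * z.im ≤ 1 := by
    have h : z.im * (2 * z.re - t) = 0 := by linarith
    rcases mul_eq_zero.mp h with h | h
    · rw [h] at hre ⊢
      have hx1 : z.re ≤ 1 := by
        by_contra! hc
        nlinarith [mul_pos (sub_pos.mpr hc) (sub_pos.mpr (hβ1.trans hc))]
      have hx2 : -1 ≤ z.re := by
        by_contra! hc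
        nlinarith [mul_pos (show 0 < -1 - z.re by linarith) (show 0 < -z.re - β by linarith)]
      nlinarith
    · have : t = 2 * z.re := by linarith
      subst this
      nlinarith
  nlinarith [norm_nonneg z]

/-- Bound from the large-eigenvalue approximation: the entries of `D^M·e₁` have
absolute value at most `M + 1`, i.e. `‖D^M e₁‖_∞ ≤ M + 1`. -/
theorem power_apply_e1_bound
    (η lam β : ℝ) (hη : 0 < η) (hlam : 0 < lam) (hβ0 : 0 ≤ β) (hβ1 : β < 1)
    (h1 : 0 < η * lam) (h2 : η * lam < 2 * (1 + β))
    (D : Matrix (Fin 2) (Fin 2) ℝ)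
    (hD : D = !![1 + β - η * lam, -β; 1, 0]) :
    ∀ M : ℕ, 0 < M → ∀ i, |(D ^ M *ᵥ ![1, 0]) i| ≤ (M : ℝ) + 1 := by
  obtain ⟨t, htd⟩ : ∃ t, t = 1 + β - η * lam := ⟨_, rfl⟩
  rw [← htd] at hD
  have ht : |t| < 1 + β := by rw [abs_lt]; constructor <;> linarith
  obtain ⟨s, hs⟩ := IsAlgClosed.exists_pow_nat_eq ((t : ℂ) ^ 2 - 4 * β) (n := 2) (by norm_num)
  obtain ⟨a, ha⟩ : ∃ a : ℂ, a = (t + s) / 2 := ⟨_, rfl⟩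
  obtain ⟨b, hb⟩ : ∃ b : ℂ, b = (t - s) / 2 := ⟨_, rfl⟩
  have hsum : (t : ℂ) = a + b := by rw [ha, hb]; ring
  have hprod : (β : ℂ) = a * b := by rw [ha, hb]; linear_combination (1 / 4 : ℂ) * hs
  have hna : ‖a‖ ≤ 1 := root_norm_le t β hβ0 hβ1 ht a (by rw [hsum, hprod]; ring)
  have hnb : ‖b‖ ≤ 1 := root_norm_le t β hβ0 hβ1 ht b (by rw [hsum, hprod]; ring)
  have main : ∀ n : ℕ, (((D ^ n *ᵥ ![1, 0]) 0 : ℝ) : ℂ) - a * ((D ^ n *ᵥ ![1, 0]) 1 : ℝ) = b ^ n ∧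
      |(D ^ n *ᵥ ![1, 0]) 0| ≤ (n : ℝ) + 1 ∧ |(D ^ n *ᵥ ![1, 0]) 1| ≤ (n : ℝ) := by
    intro n
    induction n with
    | zero => simp
    | succ n ih =>
      have e : D ^ (n + 1) *ᵥ ![1, 0] = D *ᵥ (D ^ n *ᵥ ![1, 0]) := by
        rw [pow_succ', Matrix.mulVec_mulVec]
      rw [e]
      generalize D ^ n *ᵥ ![1, 0] = v at ih ⊢
      obtain ⟨i1, i2, i3⟩ := ih
      have e0 : (D *ᵥ v) 0 = t * v 0 - β * v 1 := by
        rw [hD]; simp [Matrix.mulVec, dotProduct, Fin.sum_univ_two]; ring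
      have e1 : (D *ᵥ v) 1 = v 0 := by
        rw [hD]; simp [Matrix.mulVec, dotProduct, Fin.sum_univ_two]
      rw [e0, e1]
      have r : ((t * v 0 - β * v 1 : ℝ) : ℂ) - a * (v 0 : ℝ) = b ^ (n + 1) := by
        push_cast
        rw [pow_succ, ← i1, hsum, hprod]; ring
      refine ⟨r, ?_, by push_cast; exact i2⟩
      have r' : ((t * v 0 - β * v 1 : ℝ) : ℂ) = a * (v 0 : ℝ) + b ^ (n + 1) := by
        rw [← r]; ring
      have q : ‖((t * v 0 - β * v 1 : ℝ) : ℂ)‖ ≤ ‖a‖ * |v 0| + ‖b‖ ^ (n + 1) := by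
        rw [r']
        refine (norm_add_le _ _).trans ?_
        rw [norm_mul, norm_pow, Complex.norm_real, Real.norm_eq_abs]
      rw [Complex.norm_real, Real.norm_eq_abs] at q
      have q2 : ‖b‖ ^ (n + 1) ≤ 1 := pow_le_one₀ (norm_nonneg _) hnb
      have q3 : ‖a‖ * |v 0| ≤ |v 0| := mul_le_of_le_one_left (abs_nonneg _) hna
      push_cast
      linarith
  intro M _ i
  obtain ⟨-, m0, m1⟩ := main M
  fin_cases i
  · exact m0
  · exact m1.trans (by linarith)
end

section
/- There exists an absolute constant c > 0 such that for all reals η, λ, β with η > 0, λ > 0, 0 ≤ β < 1, 0 < ηλ < 2(1+β), and all integers M ≥ 2, the 2×2 matrix E := D·(D^M + M(I−D) − I)·(I−D)^{−2}·e₁e₁ᵀ/(M(M−1)), with D := [[1+β−ηλ, −β],[1, 0]] and e₁ := (1,0)ᵀ, satisfies ‖(E + Eᵀ)·e₁‖_∞ ≤ c/(M·(ηλ)²). -/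
open Matrix

lemma ct_root (a b : ℝ) (hb0 : 0 ≤ b) (hb : b < 1) (ha : a ≤ 1 + b) (ha' : -(1 + b) ≤ a) (r : ℂ)
    (h : r * r - a * r + b = 0) : ‖r‖ ≤ 1 := by
  have hre := congrArg Complex.re h
  have him := congrArg Complex.im h
  simp at hre him
  rw [← sq_le_one_iff₀ (norm_nonneg _), Complex.sq_norm, Complex.normSq_apply]
  rcases eq_or_ne r.im 0 with h0 | h0
  · rw [h0] at hre ⊢
    have h1 : r.re ≤ 1 := by
      by_contra! hc
      nlinarith [mul_pos (sub_pos.2 hc) (sub_pos.2 (hb.trans hc))]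
    have h2 : -1 ≤ r.re := by
      by_contra! hc
      nlinarith [mul_pos (sub_pos.2 hc) (show 0 < -r.re - b by linarith)]
    nlinarith
  · have h3 : a = 2 * r.re := by
      have : r.im * (2 * r.re - a) = 0 := by linarith
      rcases mul_eq_zero.1 this with h | h
      · exact absurd h h0
      · linarith
    subst h3
    nlinarith

lemma ct_pow (b x : ℝ) (hb0 : 0 ≤ b) (hb : b < 1) (hx : 0 < x) (hx' : x < 2 * (1 + b)) (n : ℕ) :
    |((!![1 + b - x, -b; 1, 0] : Matrix (Fin 2) (Fin 2) ℝ) ^ n) 0 0 * (1 - b)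
      + ((!![1 + b - x, -b; 1, 0] : Matrix (Fin 2) (Fin 2) ℝ) ^ n) 0 1 * (1 - b + x)| ≤ 11 + 6 * n ∧
    |((!![1 + b - x, -b; 1, 0] : Matrix (Fin 2) (Fin 2) ℝ) ^ n) 1 0 * (1 - b)
      + ((!![1 + b - x, -b; 1, 0] : Matrix (Fin 2) (Fin 2) ℝ) ^ n) 1 1 * (1 - b + x)| ≤ 5 + 6 * n := by
  obtain ⟨r, hr⟩ : ∃ r : ℂ, r * r - (1 + b - x : ℝ) * r + b = 0 := by
    obtain ⟨z, hz⟩ := IsAlgClosed.exists_eq_mul_self (((1 + b - x : ℝ) : ℂ) ^ 2 - 4 * b)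
    refine ⟨(((1 + b - x : ℝ) : ℂ) + z) / 2, ?_⟩
    linear_combination (-1 / 4) * hz
  have hr1 : ‖r‖ ≤ 1 := ct_root (1 + b - x) b hb0 hb (by linarith) (by linarith) r hr
  have hs1 : ‖((1 + b - x : ℝ) : ℂ) - r‖ ≤ 1 :=
    ct_root (1 + b - x) b hb0 hb (by linarith) (by linarith) _ (by linear_combination hr)
  set D : Matrix (Fin 2) (Fin 2) ℝ := !![1 + b - x, -b; 1, 0] with hD
  set A : ℕ → ℝ := fun n => (D ^ n) 0 0 * (1 - b) + (D ^ n) 0 1 * (1 - b + x) with hA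
  set B : ℕ → ℝ := fun n => (D ^ n) 1 0 * (1 - b) + (D ^ n) 1 1 * (1 - b + x) with hB
  have hA0 : A 0 = 1 - b := by simp [hA]
  have hB0 : B 0 = 1 - b + x := by simp [hB]
  have hAs : ∀ n, A (n + 1) = (1 + b - x) * A n - b * B n := by
    intro n
    simp only [hA, hB, pow_succ', Matrix.mul_apply, Fin.sum_univ_two]
    simp [hD]
    ring
  have hBs : ∀ n, B (n + 1) = A n := by
    intro n
    simp only [hA, hB, pow_succ', Matrix.mul_apply, Fin.sum_univ_two]
    simp [hD]
  have key : ∀ n : ℕ, ‖(A n : ℂ) - r * B n‖ ≤ 6 := by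
    intro n
    induction n with
    | zero =>
      rw [hA0, hB0]
      refine (norm_sub_le _ _).trans ?_
      rw [norm_mul, Complex.norm_real, Complex.norm_real, Real.norm_eq_abs, Real.norm_eq_abs,
        abs_of_nonneg (by linarith), abs_of_nonneg (by linarith)]
      nlinarith [norm_nonneg r]
    | succ n ih =>
      have : (A (n + 1) : ℂ) - r * B (n + 1)
          = (((1 + b - x : ℝ) : ℂ) - r) * ((A n : ℂ) - r * B n) := by
        rw [hAs, hBs]
        push_cast at hr ⊢
        linear_combination (-(B n : ℂ)) * hr
      rw [this, norm_mul]
      nlinarith [norm_nonneg ((A n : ℂ) - r * B n)]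
  have hAB : ∀ n, |A n| ≤ |B n| + 6 := by
    intro n
    have h1 : (A n : ℂ) = r * B n + ((A n : ℂ) - r * B n) := by ring
    have h2 := norm_add_le (r * (B n : ℂ)) ((A n : ℂ) - r * B n)
    rw [← h1, norm_mul, Complex.norm_real, Complex.norm_real, Real.norm_eq_abs,
      Real.norm_eq_abs] at h2
    nlinarith [key n, abs_nonneg (B n)]
  have hBn : ∀ n : ℕ, |B n| ≤ 5 + 6 * n := by
    intro n
    induction n with
    | zero => rw [hB0, abs_of_nonneg (by linarith)]; push_cast; linarith
    | succ n ih => rw [hBs]; push_cast; linarith [hAB n]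
  exact ⟨by linarith [hAB n, hBn n], hBn n⟩

lemma ct_final (t m x : ℝ) (hx : 0 < x) (hm : 2 ≤ m) (h : |t| ≤ 250 * m) :
    |(m * (m - 1))⁻¹ * (t / x ^ 2)| ≤ 500 / (m * x ^ 2) := by
  have h1 : 0 < m - 1 := by linarith
  have h2 : 0 < m := by linarith
  rw [abs_mul, abs_div, abs_of_pos (show 0 < (m * (m - 1))⁻¹ by positivity),
    abs_of_pos (show 0 < x ^ 2 by positivity), inv_mul_eq_div, div_div,
    div_le_div_iff₀ (by positivity) (by positivity)]
  have : |t| ≤ 500 * (m - 1) := by linarith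
  calc |t| * (m * x ^ 2) ≤ (500 * (m - 1)) * (m * x ^ 2) := by gcongr
    _ = _ := by ring

/-- Key estimate behind the large-Hessian-eigenvalue corollary: the correction term
`(E + Eᵀ)·e₁` coming from the epoch-based anti-correlated noise is bounded in the
maximum norm by `c/(M(ηλ)²)` for an absolute constant `c`. -/
theorem correction_term_bound :
    ∃ c : ℝ, 0 < c ∧
      ∀ (η lam β : ℝ) (M : ℕ), 0 < η → 0 < lam → 0 ≤ β → β < 1 →
        0 < η * lam → η * lam < 2 * (1 + β) → 2 ≤ M →
        ∀ i : Fin 2,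
          |((let D : Matrix (Fin 2) (Fin 2) ℝ := !![1 + β - η * lam, -β; 1, 0];
             let EE : Matrix (Fin 2) (Fin 2) ℝ :=
               ((M : ℝ) * ((M : ℝ) - 1))⁻¹ •
                 (D * (D ^ M + (M : ℝ) • (1 - D) - 1) * ((1 - D)⁻¹) ^ 2 *
                   vecMulVec ![1, 0] ![1, 0]);
             (EE + EEᵀ) *ᵥ ![1, 0]) i)| ≤ c / ((M : ℝ) * (η * lam) ^ 2) := by
  refine ⟨500, by norm_num, ?_⟩
  intro η lam β M _ _ hb0 hb hx hx' hM i
  obtain ⟨h1, h2⟩ := ct_pow β (η * lam) hb0 hb hx hx' M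
  generalize η * lam = x at *
  dsimp only
  have hm : (2 : ℝ) ≤ M := by exact_mod_cast hM
  generalize (!![1 + β - x, -β; 1, 0] : Matrix (Fin 2) (Fin 2) ℝ) ^ M = P at *
  have hinv : (1 - (!![1 + β - x, -β; 1, 0] : Matrix (Fin 2) (Fin 2) ℝ))⁻¹
      = !![1 / x, -β / x; 1 / x, (x - β) / x] := by
    apply Matrix.inv_eq_right_inv
    ext i j
    fin_cases i <;> fin_cases j <;> simp [Matrix.mul_apply, Fin.sum_univ_two] <;> field_simp <;> ring
  generalize (M : ℝ) = m at *
  have hx4 : x < 4 := by linarith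
  set A := P 0 0 * (1 - β) + P 0 1 * (1 - β + x) with hA
  set B := P 1 0 * (1 - β) + P 1 1 * (1 - β + x) with hB
  rw [abs_le] at h1 h2
  have e1 : |2 * ((1 + β - x) * A - β * B - ((1 + β - x) * (1 - β) - β * (1 - β + x))
      + m * x * (1 - x))| ≤ 250 * m := by
    have a1 : |(1 + β - x) * A| ≤ 2 * (11 + 6 * m) := by
      rw [abs_mul]
      exact mul_le_mul (abs_le.2 ⟨by linarith, by linarith⟩) (abs_le.2 h1) (abs_nonneg _) (by norm_num)
    have a2 : |β * B| ≤ 1 * (5 + 6 * m) := by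
      rw [abs_mul]
      exact mul_le_mul (abs_le.2 ⟨by linarith, by linarith⟩) (abs_le.2 h2) (abs_nonneg _) (by norm_num)
    have a3 : |m * x * (1 - x)| ≤ (m * 4) * 3 := by
      rw [abs_mul]
      refine mul_le_mul ?_ (abs_le.2 ⟨by linarith, by linarith⟩) (abs_nonneg _) (by linarith)
      rw [abs_of_nonneg (by positivity)]
      gcongr
    have a4 : |(1 + β - x) * (1 - β)| ≤ 2 * 1 := by
      rw [abs_mul]
      exact mul_le_mul (abs_le.2 ⟨by linarith, by linarith⟩) (abs_le.2 ⟨by linarith, by linarith⟩) (abs_nonneg _) (by norm_num)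
    have a5 : |β * (1 - β + x)| ≤ 1 * 5 := by
      rw [abs_mul]
      exact mul_le_mul (abs_le.2 ⟨by linarith, by linarith⟩) (abs_le.2 ⟨by linarith, by linarith⟩) (abs_nonneg _) (by norm_num)
    rw [abs_le] at *
    constructor <;> linarith [a1.1, a1.2, a2.1, a2.2, a3.1, a3.2, a4.1, a4.2, a5.1, a5.2]
  have e2 : |A - (1 - β) + m * x| ≤ 250 * m := by
    have : 0 ≤ m * x := by positivity
    have : m * x ≤ m * 4 := by gcongr
    rw [abs_le]
    constructor <;> linarith [h1.1, h1.2]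
  fin_cases i
  · refine le_of_eq_of_le (congrArg _ ?_) (ct_final _ m x hx hm e1)
    simp only [hinv, hA, hB]
    simp only [Matrix.mulVec, dotProduct, Fin.sum_univ_two, Matrix.add_apply, Matrix.smul_apply,
      Matrix.transpose_apply, Matrix.mul_apply, Matrix.sub_apply, pow_two, vecMulVec_apply]
    simp
    have hm1 : m - 1 ≠ 0 := (by linarith : (0:ℝ) < m - 1).ne'
    field_simp
    ring
  · refine le_of_eq_of_le (congrArg _ ?_) (ct_final _ m x hx hm e2)
    simp only [hinv, hA, hB]
    simp only [Matrix.mulVec, dotProduct, Fin.sum_univ_two, Matrix.add_apply, Matrix.smul_apply,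
      Matrix.transpose_apply, Matrix.mul_apply, Matrix.sub_apply, pow_two, vecMulVec_apply]
    simp
    left
    have hm1 : m - 1 ≠ 0 := (by linarith : (0:ℝ) < m - 1).ne'
    field_simp
    ring
end

section
/- There exist absolute constants c₁, c₂ > 0 with the following property. For all reals η, λ, β, σ² with η > 0, λ > 0, 0 ≤ β < 1, 0 < ηλ < 2(1+β), σ² > 0, and all integers M ≥ 2, define D := [[1+β−ηλ, −β],[1, 0]], e₁ := (1,0)ᵀ, E := D·(D^M + M(I−D) − I)·(I−D)^{−2}·e₁e₁ᵀ/(M(M−1)), F := (1/((1−β)(2(1+β)−ηλ)))·[[(1+β)/(ηλ), 2β(ηλ−1−β)/(ηλ)],[2, 2(ηλ−2)]], and (σ_θ², σ_v²)ᵀ := η²σ²·F·[e₁ − (E + Eᵀ)·e₁], and define σ_{θ,large}² := η²σ²·(1+β)/((1−β)(2(1+β)−ηλ)·ηλ) and σ_{v,large}² := 2η²σ²/((1−β)(2(1+β)−ηλ)). Then |1 − σ_θ²/σ_{θ,large}²| ≤ c₁/(M·(ηλ)²) and |1 − σ_v²/σ_{v,large}²| ≤ c₂/(M·(ηλ)²).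 -/
open Matrix

lemma aux_root_le (t β : ℝ) (h0 : 0 ≤ β) (h1 : β < 1) (ht : |t| ≤ 1 + β) (z : ℂ)
    (hz : z * z - t * z + β = 0) : ‖z‖ ≤ 1 := by
  obtain ⟨ht1, ht2⟩ := abs_le.1 ht
  have hre := congrArg Complex.re hz
  have him := congrArg Complex.im hz
  simp at hre him
  have hsq : ‖z‖ ^ 2 ≤ 1 := by
    rw [Complex.sq_norm, Complex.normSq_apply]
    generalize z.re = a at *
    generalize z.im = b at *
    by_cases hb : b = 0
    · subst hb
      have h : a * a - t * a + β = 0 := by linarith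
      have ha : a ≤ 1 := by
        by_contra hc
        push Not at hc
        nlinarith [mul_pos (sub_pos.2 hc) (sub_pos.2 (h1.trans hc))]
      have ha' : -1 ≤ a := by
        by_contra hc
        push Not at hc
        nlinarith [mul_pos (show 0 < -a - 1 by linarith) (show 0 < -a - β by linarith)]
      nlinarith
    · have h2 : t = 2 * a := by
        apply mul_right_cancel₀ hb
        linarith
      subst h2
      nlinarith
  nlinarith [norm_nonneg z]

lemma aux_seq (t β : ℝ) (h0 : 0 ≤ β) (h1 : β < 1) (ht : |t| ≤ 1 + β) (U : ℕ → ℝ)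
    (hU0 : U 0 = 0) (hU1 : U 1 = 1) (hU : ∀ n, U (n + 2) = t * U (n + 1) - β * U n) (n : ℕ) :
    |U n| ≤ n := by
  obtain ⟨d, hd⟩ := IsAlgClosed.exists_pow_nat_eq ((t : ℂ) ^ 2 - 4 * β) (n := 2) (by norm_num)
  obtain ⟨z, hzdef⟩ : ∃ z : ℂ, z = (t + d) / 2 := ⟨_, rfl⟩
  have hz : z * z - t * z + β = 0 := by
    subst hzdef
    linear_combination hd / 4
  have hw : (t - z) * (t - z) - t * (t - z) + β = 0 := by linear_combination hz
  have nz := aux_root_le t β h0 h1 ht z hz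
  have nw := aux_root_le t β h0 h1 ht _ hw
  have key : ∀ n, (U (n + 1) : ℂ) = z * U n + (t - z) ^ n := by
    intro n
    induction n with
    | zero => simp [hU0, hU1]
    | succ k ih =>
      rw [hU k, pow_succ]
      push_cast
      linear_combination (t - z) * ih - (U k : ℂ) * hz
  have : ∀ n, ‖(U n : ℂ)‖ ≤ n := by
    intro n
    induction n with
    | zero => simp [hU0]
    | succ k ih =>
      rw [key k]
      push_cast
      refine (norm_add_le _ _).trans ?_
      rw [norm_mul, norm_pow]
      have := pow_le_one₀ (n := k) (norm_nonneg _) nw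
      nlinarith [norm_nonneg z, norm_nonneg (U k : ℂ)]
  simpa using this n

lemma aux_pow (t β : ℝ) (h0 : 0 ≤ β) (h1 : β < 1) (ht : |t| ≤ 1 + β) (n : ℕ) (i j : Fin 2) :
    |((!![t, -β; 1, 0] : Matrix (Fin 2) (Fin 2) ℝ) ^ n) i j| ≤ n + 1 := by
  set D : Matrix (Fin 2) (Fin 2) ℝ := !![t, -β; 1, 0] with hD
  have r0 : ∀ n j, (D ^ (n + 1)) 0 j = t * (D ^ n) 0 j - β * (D ^ n) 1 j := by
    intro n j
    rw [pow_succ', Matrix.mul_apply, Fin.sum_univ_two]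
    simp [hD]
    ring
  have r1 : ∀ n j, (D ^ (n + 1)) 1 j = (D ^ n) 0 j := by
    intro n j
    rw [pow_succ', Matrix.mul_apply, Fin.sum_univ_two]
    simp [hD]
  have c1 : ∀ n i, (D ^ (n + 1)) i 1 = -β * (D ^ n) i 0 := by
    intro n i
    rw [pow_succ, Matrix.mul_apply, Fin.sum_univ_two]
    simp [hD]
    ring
  have hs : ∀ n : ℕ, |(D ^ n) 1 0| ≤ n := by
    apply aux_seq t β h0 h1 ht (fun n => (D ^ n) 1 0)
    · simp
    · simp [hD]
    · intro n
      show (D ^ (n + 2)) 1 0 = t * (D ^ (n + 1)) 1 0 - β * (D ^ n) 1 0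
      rw [r1 (n + 1), r0, r1 n]
  have h00 : ∀ n : ℕ, |(D ^ n) 0 0| ≤ n + 1 := by
    intro n
    rw [← r1]
    exact_mod_cast hs (n + 1)
  have h10 : ∀ n : ℕ, |(D ^ n) 1 0| ≤ n + 1 := fun n => (hs n).trans (by linarith)
  have hb : ∀ (y : ℝ) (n : ℕ), |y| ≤ n + 1 → |-β * y| ≤ (n + 1 : ℕ) + 1 := by
    intro y n hy
    rw [abs_mul, abs_neg, abs_of_nonneg h0]
    push_cast
    nlinarith [abs_nonneg y]
  fin_cases j
  · fin_cases i
    · exact h00 n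
    · exact h10 n
  · cases n with
    | zero => fin_cases i <;> simp
    | succ k =>
      fin_cases i
      · show |(D ^ (k + 1)) 0 1| ≤ _
        rw [c1]
        exact hb _ _ (h00 k)
      · show |(D ^ (k + 1)) 1 1| ≤ _
        rw [c1]
        exact hb _ _ (h10 k)

lemma aux_mul {a b A B : ℝ} (ha : |a| ≤ A) (hb : |b| ≤ B) : |a * b| ≤ A * B := by
  rw [abs_mul]
  exact mul_le_mul ha hb (abs_nonneg _) ((abs_nonneg _).trans ha)

lemma aux_inv (x β : ℝ) (hx : x ≠ 0) :
    (1 - !![1 + β - x, -β; 1, 0] : Matrix (Fin 2) (Fin 2) ℝ)⁻¹ =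
      !![x⁻¹, -β * x⁻¹; x⁻¹, (x - β) * x⁻¹] := by
  apply Matrix.inv_eq_right_inv
  ext i j
  fin_cases i <;> fin_cases j <;> simp [Matrix.mul_apply, Fin.sum_univ_two] <;> field_simp <;> ring

/-- Quantitative form of the large-Hessian-eigenvalue corollary: the exact
stationary weight and velocity variances of SGD with momentum and epoch-based
anti-correlated noise agree with the uncorrelated-noise values up to relative
error `O(1/(M(ηλ)²))`. -/
theorem large_eigenvalue_variance_approximation :
    ∃ c₁ c₂ : ℝ, 0 < c₁ ∧ 0 < c₂ ∧
      ∀ (η lam β σ2 : ℝ) (M : ℕ), 0 < η → 0 < lam → 0 ≤ β → β < 1 →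
        0 < η * lam → η * lam < 2 * (1 + β) → 0 < σ2 → 2 ≤ M →
        (let D : Matrix (Fin 2) (Fin 2) ℝ := !![1 + β - η * lam, -β; 1, 0];
         let EE : Matrix (Fin 2) (Fin 2) ℝ :=
           ((M : ℝ) * ((M : ℝ) - 1))⁻¹ •
             (D * (D ^ M + (M : ℝ) • (1 - D) - 1) * ((1 - D)⁻¹) ^ 2 *
               vecMulVec ![1, 0] ![1, 0]);
         let F : Matrix (Fin 2) (Fin 2) ℝ :=
           ((1 - β) * (2 * (1 + β) - η * lam))⁻¹ •
             !![(1 + β) / (η * lam), 2 * β * (η * lam - 1 - β) / (η * lam);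
                2, 2 * (η * lam - 2)];
         let σθ2 : ℝ := ((η ^ 2 * σ2) • (F *ᵥ (![1, 0] - (EE + EEᵀ) *ᵥ ![1, 0]))) 0;
         let σv2 : ℝ := ((η ^ 2 * σ2) • (F *ᵥ (![1, 0] - (EE + EEᵀ) *ᵥ ![1, 0]))) 1;
         let σθlarge2 : ℝ :=
           η ^ 2 * σ2 * (1 + β) / ((1 - β) * (2 * (1 + β) - η * lam) * (η * lam));
         let σvlarge2 : ℝ := 2 * η ^ 2 * σ2 / ((1 - β) * (2 * (1 + β) - η * lam));
         |1 - σθ2 / σθlarge2| ≤ c₁ / ((M : ℝ) * (η * lam) ^ 2) ∧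
         |1 - σv2 / σvlarge2| ≤ c₂ / ((M : ℝ) * (η * lam) ^ 2)) := by
  refine ⟨1000, 1000, by norm_num, by norm_num, ?_⟩
  intro η lam β σ2 M hη hlam h0 h1 hx hx2 hσ hM
  intro D EE F σθ2 σv2 σθlarge2 σvlarge2
  obtain ⟨x, hxdef⟩ : ∃ x, x = η * lam := ⟨_, rfl⟩
  have hMr : (2 : ℝ) ≤ M := by exact_mod_cast hM
  have ht : |1 + β - x| ≤ 1 + β := by rw [abs_le]; constructor <;> linarith
  obtain ⟨P, hP⟩ : ∃ P, P = D ^ M := ⟨_, rfl⟩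
  have hPb : ∀ i j, |P i j| ≤ M + 1 := by
    intro i j
    have := aux_pow (1 + β - x) β h0 h1 ht M i j
    rw [hP]
    simpa only [D, hxdef] using this
  have hEE : EE = ((M : ℝ) * ((M : ℝ) - 1))⁻¹ •
             (D * (P + (M : ℝ) • (1 - D) - 1) * ((1 - D)⁻¹) ^ 2 *
               vecMulVec ![1, 0] ![1, 0]) := by rw [hP]
  have hinv : (1 - D)⁻¹ = !![x⁻¹, -β * x⁻¹; x⁻¹, (x - β) * x⁻¹] := by
    simp only [D, ← hxdef]
    exact aux_inv x β (by rw [hxdef]; exact hx.ne')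
  rw [hinv] at hEE
  rw [← hxdef] at hx hx2
  have hx0 : x ≠ 0 := hx.ne'
  have hM0 : (M : ℝ) ≠ 0 := by linarith
  have hM1 : (M : ℝ) - 1 ≠ 0 := by linarith
  obtain ⟨na, hna⟩ : ∃ na, na = ((1 + β - x) * P 0 0 - β * P 1 0 - (1 + β - x)) * (1 - β)
      + ((1 + β - x) * P 0 1 - β * P 1 1 + β) * (1 + x - β) + M * (x * (1 - x)) := ⟨_, rfl⟩
  obtain ⟨nb, hnb⟩ : ∃ nb, nb = (P 0 0 - 1) * (1 - β) + P 0 1 * (1 + x - β) + M * x := ⟨_, rfl⟩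
  have e00 : EE 0 0 = na / (x ^ 2 * (M * (M - 1))) := by
    rw [hEE, hna]
    simp only [pow_two, Matrix.smul_apply, Matrix.mul_apply, Matrix.add_apply, Matrix.sub_apply,
      Fin.sum_univ_two, vecMulVec_apply]
    simp [D, ← hxdef]
    field_simp
    ring
  have e10 : EE 1 0 = nb / (x ^ 2 * (M * (M - 1))) := by
    rw [hEE, hnb]
    simp only [pow_two, Matrix.smul_apply, Matrix.mul_apply, Matrix.add_apply, Matrix.sub_apply,
      Fin.sum_univ_two, vecMulVec_apply]
    simp [D, ← hxdef]
    field_simp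
    ring
  have e01 : EE 0 1 = 0 := by
    rw [hEE]
    simp [Matrix.mul_apply, Fin.sum_univ_two, vecMulVec_apply]
  have hβ : 1 - β ≠ 0 := by linarith
  have hβ' : 1 + β ≠ 0 := by linarith
  have hk : 2 * (1 + β) - x ≠ 0 := by linarith
  have hq1 : 1 - σθ2 / σθlarge2 = 2 * EE 0 0 + 2 * (x - 1 - β) * (β / (1 + β)) * EE 1 0 := by
    simp only [σθ2, σθlarge2, F, ← hxdef]
    simp [Matrix.mulVec, dotProduct, Fin.sum_univ_two, e01]
    field_simp
    ring
  have hq2 : 1 - σv2 / σvlarge2 = 2 * EE 0 0 + (x - 2) * EE 1 0 := by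
    simp only [σv2, σvlarge2, F, ← hxdef]
    simp [Matrix.mulVec, dotProduct, Fin.sum_univ_two, e01]
    field_simp
    ring
  have b1 : |1 + β - x| ≤ 2 := by linarith
  have b2 : |β| ≤ 1 := by rw [abs_of_nonneg h0]; linarith
  have b3 : |1 - β| ≤ 1 := by rw [abs_le]; constructor <;> linarith
  have b4 : |1 + x - β| ≤ 5 := by rw [abs_le]; constructor <;> linarith
  have b5 : |x * (1 - x)| ≤ 4 * 3 := by
    apply aux_mul <;> rw [abs_le] <;> constructor <;> linarith
  have bM : |(M : ℝ)| ≤ M := by rw [abs_of_nonneg]; linarith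
  have bx : |x| ≤ 4 := by rw [abs_le]; constructor <;> linarith
  have bna : |na| ≤ 85 * (M - 1) := by
    have q1 : |(1 + β - x) * P 0 0 - β * P 1 0 - (1 + β - x)| ≤ 3 * (M + 1) + 2 := by
      have := abs_le.1 (aux_mul b1 (hPb 0 0))
      have := abs_le.1 (aux_mul b2 (hPb 1 0))
      have := abs_le.1 b1
      rw [abs_le]; constructor <;> linarith
    have q2 : |(1 + β - x) * P 0 1 - β * P 1 1 + β| ≤ 3 * (M + 1) + 1 := by
      have := abs_le.1 (aux_mul b1 (hPb 0 1))
      have := abs_le.1 (aux_mul b2 (hPb 1 1))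
      have := abs_le.1 b2
      rw [abs_le]; constructor <;> linarith
    have := abs_le.1 (aux_mul q1 b3)
    have := abs_le.1 (aux_mul q2 b4)
    have := abs_le.1 (aux_mul bM b5)
    rw [hna, abs_le]; constructor <;> linarith
  have bnb : |nb| ≤ 27 * (M - 1) := by
    have q1 : |P 0 0 - 1| ≤ M + 2 := by
      have := abs_le.1 (hPb 0 0)
      rw [abs_le]; constructor <;> linarith
    have := abs_le.1 (aux_mul q1 b3)
    have := abs_le.1 (aux_mul (hPb 0 1) b4)
    have := abs_le.1 (aux_mul bM bx)
    rw [hnb, abs_le]; constructor <;> linarith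
  have hMpos : (0 : ℝ) < M - 1 := by linarith
  have hMp : (0 : ℝ) < M := by linarith
  have gen : ∀ (c n : ℝ), |n| ≤ c * (M - 1) →
      |n / (x ^ 2 * (M * (M - 1)))| ≤ c / (M * x ^ 2) := by
    intro c n h
    rw [abs_div, abs_of_pos (show 0 < x ^ 2 * (M * ((M : ℝ) - 1)) by positivity),
      div_le_div_iff₀ (by positivity) (by positivity)]
    calc |n| * (M * x ^ 2) ≤ (c * (M - 1)) * (M * x ^ 2) := by gcongr
      _ = c * (x ^ 2 * (M * (M - 1))) := by ring
  have b7 : |β / (1 + β)| ≤ 1 := by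
    rw [abs_of_nonneg (by positivity), div_le_one (by positivity)]
    linarith
  rw [hq1, hq2, e00, e10, ← hxdef]
  constructor
  · have q := aux_mul (aux_mul (show |2 * (x - 1 - β)| ≤ 4 by
      rw [abs_le] at b1 ⊢; constructor <;> linarith) b7) bnb
    rw [← mul_div_assoc, ← mul_div_assoc, ← add_div]
    apply gen
    have := abs_le.1 q
    have := abs_le.1 bna
    rw [abs_le]; constructor <;> linarith
  · have q := aux_mul (show |x - 2| ≤ 2 by
      rw [abs_le]; constructor <;> linarith) bnb
    rw [← mul_div_assoc, ← mul_div_assoc, ← add_div]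
    apply gen
    have := abs_le.1 q
    have := abs_le.1 bna
    rw [abs_le]; constructor <;> linarith
end

section
/- Let d be a positive integer, η > 0, 0 ≤ β < 1 reals, M ≥ 2 an integer, and let C, H be symmetric real d×d matrices with C·H = H·C, C positive semidefinite, and every eigenvalue λ of H satisfying 0 < ηλ < 2(1+β). Define ρ(m) := δ_{m,0} − 𝟙_{1≤|m|≤M}·(M−|m|)/(M(M−1)) for m ∈ ℤ, the 2d×2d block matrices X := [[I−ηH, βI],[−ηH, βI]] and Z_m := η²·ρ(m)·[[C, C],[C, C]]. Then the limit Y := lim_{h→∞} ∑_{i=1}^{h} ∑_{j=1}^{h} X^{h−i}·Z_{i−j}·(Xᵀ)^{h−j} exists, and each of the four d×d blocks of Y commutes with C, with H, and with each of the other blocks. In particular the stationary weight covariance Σ (the top-left block of Y) and the stationary velocity covariance Σ_v (the bottom-right block of Y) commute with C, with H, and with each other. -/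
open Matrix Filter Finset

section Helpers

attribute [local instance] Matrix.frobeniusNormedRing Matrix.frobeniusNormedAlgebra

/-- Jury stability of the scalar heavy-ball polynomial. -/
lemma hb_root_norm_lt_one (β s : ℝ) (hβ0 : 0 ≤ β) (hβ1 : β < 1) (hs0 : 0 < s)
    (hs1 : s < 2 * (1 + β)) (z : ℂ)
    (hz : (z - β) * (z - 1) = -(s * z)) : ‖z‖ < 1 := by
  have hre := congrArg Complex.re hz
  have him := congrArg Complex.im hz
  simp at hre him
  obtain ⟨x, y⟩ := z
  simp only at hre him
  have hn : ‖(⟨x, y⟩ : ℂ)‖ ^ 2 = x ^ 2 + y ^ 2 := by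
    rw [Complex.sq_norm, Complex.normSq_mk]; ring
  suffices h : x ^ 2 + y ^ 2 < 1 by
    rw [← hn] at h
    nlinarith [norm_nonneg (⟨x, y⟩ : ℂ)]
  by_cases hy : y = 0
  · subst hy
    have h1 : x < 1 := by
      by_contra hx
      push Not at hx
      nlinarith [mul_nonneg (sub_nonneg.2 hx) (by linarith : (0:ℝ) ≤ x - β), mul_pos hs0 (by linarith : 0 < x)]
    have h2 : -1 < x := by
      by_contra hx
      push Not at hx
      nlinarith [mul_nonneg (by linarith : (0:ℝ) ≤ -x - 1) (by linarith : (0:ℝ) ≤ -x - β),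
        mul_pos (by linarith : 0 < 2 * (1 + β) - s) (by linarith : 0 < -x)]
    nlinarith
  · have h : 2 * x = 1 + β - s := by
      apply mul_left_cancel₀ hy
      linarith
    have hs : s = 1 + β - 2 * x := by linarith
    subst hs
    nlinarith

lemma summable_norm_pow_of_spectrum {n : Type*} [Fintype n] [DecidableEq n]
    (A : Matrix n n ℂ) (h : ∀ z ∈ spectrum ℂ A, ‖z‖ < 1) :
    Summable fun k : ℕ => ‖A ^ k‖ := by
  cases isEmpty_or_nonempty n
  · have : ∀ k : ℕ, ‖A ^ k‖ = 0 := fun k => by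
      rw [Subsingleton.elim (A ^ k) 0, norm_zero]
    simp [this]
  have : CompleteSpace (Matrix n n ℂ) := FiniteDimensional.complete ℂ _
  have h1 : spectralRadius ℂ A < ((1 : NNReal) : ENNReal) :=
    spectrum.spectralRadius_lt_of_forall_lt A (fun z hz => by
      rw [← NNReal.coe_lt_coe]; simpa using h z hz)
  obtain ⟨r, hr1, hr2⟩ := ENNReal.lt_iff_exists_nnreal_btwn.1 h1
  have ht := spectrum.pow_nnnorm_pow_one_div_tendsto_nhds_spectralRadius A
  have hev := ht.eventually_lt_const hr1
  have hr3 : r < 1 := by exact_mod_cast hr2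
  have hg : Summable fun k : ℕ => (r : ℝ) ^ k :=
    summable_geometric_of_lt_one r.2 hr3
  refine summable_of_isBigO_nat hg (Asymptotics.IsBigO.of_bound 1 ?_)
  filter_upwards [hev, eventually_gt_atTop 0] with k hk hk0
  have hk' : (‖A ^ k‖₊ : ENNReal) ≤ (r : ENNReal) ^ k := by
    have := ENNReal.rpow_le_rpow hk.le (Nat.cast_nonneg (α := ℝ) k)
    rw [← ENNReal.rpow_mul, one_div, inv_mul_cancel₀ (by positivity), ENNReal.rpow_one,
      ENNReal.rpow_natCast] at this
    exact this
  have hk2 : ‖A ^ k‖₊ ≤ r ^ k := by exact_mod_cast hk'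
  have hk3 : ‖A ^ k‖ ≤ (r : ℝ) ^ k := by exact_mod_cast hk2
  simpa using hk3

lemma hb_eigen {d : ℕ} (η β : ℝ) (H : Matrix (Fin d) (Fin d) ℂ) (z : ℂ) (hz0 : z ≠ 0) (hη : 0 < η)
    (hz : z ∈ spectrum ℂ (Matrix.fromBlocks (1 - (η : ℂ) • H) ((β : ℂ) • (1 : Matrix (Fin d) (Fin d) ℂ))
      (-((η : ℂ) • H)) ((β : ℂ) • (1 : Matrix (Fin d) (Fin d) ℂ)))) :
    ∃ l : ℂ, H.charpoly.eval l = 0 ∧ (z - β) * (z - 1) = -((η * l) * z) := by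
  rw [spectrum.mem_iff, Matrix.isUnit_iff_isUnit_det, isUnit_iff_ne_zero, not_not,
    ← Matrix.exists_mulVec_eq_zero_iff] at hz
  obtain ⟨u, hu, hu0⟩ := hz
  obtain ⟨w, v, rfl⟩ : ∃ w v, u = Sum.elim w v :=
    ⟨u ∘ Sum.inl, u ∘ Sum.inr, (Sum.elim_comp_inl_inr u).symm⟩
  rw [Algebra.algebraMap_eq_smul_one, Matrix.sub_mulVec, Matrix.smul_mulVec, Matrix.one_mulVec,
    Matrix.fromBlocks_mulVec, sub_eq_zero] at hu0
  have e1 : ∀ i, z * w i = w i - η * (H *ᵥ w) i + β * v i := fun i => by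
    have := congrFun hu0 (Sum.inl i)
    simpa [Matrix.sub_mulVec, Matrix.smul_mulVec] using this
  have e2 : ∀ i, z * v i = - (η * (H *ᵥ w) i) + β * v i := fun i => by
    have := congrFun hu0 (Sum.inr i)
    simpa [Matrix.neg_mulVec, Matrix.smul_mulVec] using this
  have hηc : (η : ℂ) ≠ 0 := by exact_mod_cast hη.ne'
  have e3 : ∀ i, z * v i = (z - 1) * w i := fun i => by linear_combination e2 i - e1 i
  have hw : w ≠ 0 := by
    rintro rfl
    apply hu
    ext (i | i)
    · simp
    · have := e3 i
      simpa [hz0] using this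
  refine ⟨-((z - β) * (z - 1)) / (η * z), ?_, by field_simp⟩
  rw [Matrix.eval_charpoly, ← Matrix.exists_mulVec_eq_zero_iff]
  refine ⟨w, hw, ?_⟩
  ext i
  have e4 : η * z * (H *ᵥ w) i = -((z - β) * (z - 1)) * w i := by
    linear_combination z * e2 i - (z - β) * e3 i
  rw [Matrix.sub_mulVec]
  simp [Matrix.scalar_apply, Matrix.mulVec_diagonal]
  field_simp
  linear_combination - e4

lemma hb_summable {d : ℕ} (η β : ℝ) (hη : 0 < η) (hβ0 : 0 ≤ β) (hβ1 : β < 1)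
    (H : Matrix (Fin d) (Fin d) ℝ) (hHs : H.IsHermitian)
    (heig : ∀ i, 0 < η * hHs.eigenvalues i ∧ η * hHs.eigenvalues i < 2 * (1 + β))
    (X : Matrix (Fin d ⊕ Fin d) (Fin d ⊕ Fin d) ℝ)
    (hX : X = Matrix.fromBlocks (1 - η • H) (β • (1 : Matrix (Fin d) (Fin d) ℝ))
      (-(η • H)) (β • (1 : Matrix (Fin d) (Fin d) ℝ))) :
    Summable fun k : ℕ => ‖X ^ k‖ := by
  have hmap : X.map Complex.ofRealHom = Matrix.fromBlocks
      (1 - (η : ℂ) • H.map Complex.ofRealHom) ((β : ℂ) • (1 : Matrix (Fin d) (Fin d) ℂ))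
      (-((η : ℂ) • H.map Complex.ofRealHom)) ((β : ℂ) • (1 : Matrix (Fin d) (Fin d) ℂ)) := by
    subst hX
    rw [Matrix.fromBlocks_map]
    congr 1 <;> ext i j <;> simp [Matrix.one_apply] <;> split_ifs <;> simp
  have hs := summable_norm_pow_of_spectrum (X.map Complex.ofRealHom) (by
    intro z hz
    by_cases hz0 : z = 0
    · simp [hz0]
    rw [hmap] at hz
    obtain ⟨l, hl, hlz⟩ := hb_eigen η β _ z hz0 hη hz
    rw [Matrix.charpoly_map, hHs.charpoly_eq, Polynomial.map_prod, Polynomial.eval_prod,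
      Finset.prod_eq_zero_iff] at hl
    obtain ⟨i, -, hi⟩ := hl
    have hi' : l = (hHs.eigenvalues i : ℂ) := by
      simpa [sub_eq_zero] using hi
    refine hb_root_norm_lt_one β (η * hHs.eigenvalues i) hβ0 hβ1 (heig i).1 (heig i).2 z ?_
    rw [hlz, hi']; push_cast; ring)
  refine hs.congr fun k => ?_
  rw [← Matrix.map_pow, Matrix.frobenius_norm_map_eq]
  intro a; simp

lemma hb_hasSum {n : Type*} [Fintype n] [DecidableEq n] (X W : Matrix n n ℝ) (c : ℤ → ℝ) (K : ℝ)
    (hc : ∀ m, |c m| ≤ K) (hX : Summable fun k : ℕ => ‖X ^ k‖) :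
    ∃ Y : Matrix n n ℝ,
      Tendsto (fun h : ℕ => ∑ i ∈ Finset.Icc 1 h, ∑ j ∈ Finset.Icc 1 h,
        X ^ (h - i) * (c ((i : ℤ) - (j : ℤ)) • W) * (Xᵀ) ^ (h - j)) atTop (nhds Y) := by
  have : CompleteSpace (Matrix n n ℝ) := FiniteDimensional.complete ℝ _
  let f : ℕ × ℕ → Matrix n n ℝ := fun p => X ^ p.1 * (c ((p.2 : ℤ) - p.1) • W) * (Xᵀ) ^ p.2
  have hf : Summable f := by
    refine Summable.of_norm_bounded (g := fun p : ℕ × ℕ => (K * ‖W‖) * (‖X ^ p.1‖ * ‖X ^ p.2‖)) ?_ ?_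
    · exact (Summable.mul_of_nonneg hX hX (fun _ => norm_nonneg _) (fun _ => norm_nonneg _)).mul_left _
    · rintro ⟨a, b⟩
      have h1 : ‖(Xᵀ) ^ b‖ = ‖X ^ b‖ := by
        rw [← Matrix.transpose_pow, Matrix.frobenius_norm_transpose]
      calc ‖f (a, b)‖ ≤ ‖X ^ a * (c ((b : ℤ) - a) • W)‖ * ‖(Xᵀ) ^ b‖ := norm_mul_le _ _
        _ ≤ (‖X ^ a‖ * ‖c ((b : ℤ) - a) • W‖) * ‖(Xᵀ) ^ b‖ := by
          gcongr; exact norm_mul_le _ _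
        _ ≤ (‖X ^ a‖ * (K * ‖W‖)) * ‖X ^ b‖ := by
          rw [h1, norm_smul, Real.norm_eq_abs]
          gcongr
          exact hc _
        _ = _ := by ring
  refine ⟨∑' p, f p, ?_⟩
  have ht : Tendsto (fun h : ℕ => Finset.range h ×ˢ Finset.range h) atTop atTop := by
    refine tendsto_atTop_finset_of_monotone ?_ ?_
    · intro a b hab
      exact Finset.product_subset_product (Finset.range_mono hab) (Finset.range_mono hab)
    · rintro ⟨a, b⟩
      refine ⟨max a b + 1, ?_⟩
      simp only [Finset.mem_product, Finset.mem_range]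
      omega
  refine (hf.hasSum.comp ht).congr fun h => ?_
  simp only [Function.comp]
  rw [← Finset.sum_product']
  symm
  refine Finset.sum_bij' (fun p _ => (h - p.1, h - p.2)) (fun p _ => (h - p.1, h - p.2)) ?_ ?_ ?_ ?_ ?_
  · rintro ⟨a, b⟩ hab; simp at hab ⊢; omega
  · rintro ⟨a, b⟩ hab; simp at hab ⊢; omega
  · rintro ⟨a, b⟩ hab; simp at hab ⊢; omega
  · rintro ⟨a, b⟩ hab; simp at hab ⊢; omega
  · rintro ⟨a, b⟩ hab
    simp at hab
    have : ((h - b : ℕ) : ℤ) - ((h - a : ℕ) : ℤ) = (a : ℤ) - b := by omega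
    simp only [f, this]

end Helpers

/-- Matrices all of whose blocks lie in a subalgebra. -/
def blocksIn {d : ℕ} (S : Subalgebra ℝ (Matrix (Fin d) (Fin d) ℝ)) :
    Subalgebra ℝ (Matrix (Fin d ⊕ Fin d) (Fin d ⊕ Fin d) ℝ) where
  carrier := {Y | Y.toBlocks₁₁ ∈ S ∧ Y.toBlocks₁₂ ∈ S ∧ Y.toBlocks₂₁ ∈ S ∧ Y.toBlocks₂₂ ∈ S}
  mul_mem' := by
    rintro a b ⟨a1, a2, a3, a4⟩ ⟨b1, b2, b3, b4⟩
    rw [← Matrix.fromBlocks_toBlocks a, ← Matrix.fromBlocks_toBlocks b, Matrix.fromBlocks_multiply]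
    exact ⟨S.add_mem (S.mul_mem a1 b1) (S.mul_mem a2 b3), S.add_mem (S.mul_mem a1 b2) (S.mul_mem a2 b4),
      S.add_mem (S.mul_mem a3 b1) (S.mul_mem a4 b3), S.add_mem (S.mul_mem a3 b2) (S.mul_mem a4 b4)⟩
  add_mem' := by
    rintro a b ⟨a1, a2, a3, a4⟩ ⟨b1, b2, b3, b4⟩
    exact ⟨S.add_mem a1 b1, S.add_mem a2 b2, S.add_mem a3 b3, S.add_mem a4 b4⟩
  algebraMap_mem' := by
    intro r
    rw [Algebra.algebraMap_eq_smul_one, ← Matrix.fromBlocks_one, Matrix.fromBlocks_smul]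
    exact ⟨S.smul_mem S.one_mem r, S.smul_mem S.zero_mem r, S.smul_mem S.zero_mem r,
      S.smul_mem S.one_mem r⟩

/-- Appendix B.1 of the paper: the stationary joint weight–velocity covariance of
SGD with heavy-ball momentum near a quadratic minimum, with weight-independent
epoch-based noise whose covariance `C` commutes with the Hessian `H`, exists as
the limit of the stated series, and its four blocks (in particular the stationary
weight covariance `Σ` and velocity covariance `Σ_v`) commute with `C`, with `H`,
and with each other. -/
theorem stationary_covariance_blocks_commute
    {d : ℕ} (hd : 0 < d) (η β : ℝ) (hη : 0 < η) (hβ0 : 0 ≤ β) (hβ1 : β < 1)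
    (M : ℕ) (hM : 2 ≤ M)
    (C H : Matrix (Fin d) (Fin d) ℝ)
    (hCs : C.IsSymm) (hHs : H.IsHermitian)
    (hcomm : C * H = H * C) (hpsd : C.PosSemidef)
    (heig : ∀ i, 0 < η * hHs.eigenvalues i ∧ η * hHs.eigenvalues i < 2 * (1 + β))
    (ρ : ℤ → ℝ)
    (hρ : ∀ m : ℤ, ρ m = (if m = 0 then (1 : ℝ) else 0) -
      (if 1 ≤ |m| ∧ |m| ≤ (M : ℤ) then ((M : ℝ) - ((|m| : ℤ) : ℝ)) / ((M : ℝ) * ((M : ℝ) - 1)) else 0))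
    (X : Matrix (Fin d ⊕ Fin d) (Fin d ⊕ Fin d) ℝ)
    (hX : X = Matrix.fromBlocks (1 - η • H) (β • (1 : Matrix (Fin d) (Fin d) ℝ))
      (-(η • H)) (β • (1 : Matrix (Fin d) (Fin d) ℝ)))
    (Z : ℤ → Matrix (Fin d ⊕ Fin d) (Fin d ⊕ Fin d) ℝ)
    (hZ : ∀ m : ℤ, Z m = (η ^ 2 * ρ m) • Matrix.fromBlocks C C C C) :
    ∃ Y : Matrix (Fin d ⊕ Fin d) (Fin d ⊕ Fin d) ℝ,
      Tendsto (fun h : ℕ => ∑ i ∈ Finset.Icc 1 h, ∑ j ∈ Finset.Icc 1 h,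
        X ^ (h - i) * Z ((i : ℤ) - (j : ℤ)) * (Xᵀ) ^ (h - j)) atTop (nhds Y) ∧
      ∀ P ∈ ({Y.toBlocks₁₁, Y.toBlocks₁₂, Y.toBlocks₂₁, Y.toBlocks₂₂} :
          Set (Matrix (Fin d) (Fin d) ℝ)),
        Commute P C ∧ Commute P H ∧
        ∀ Q ∈ ({Y.toBlocks₁₁, Y.toBlocks₁₂, Y.toBlocks₂₁, Y.toBlocks₂₂} :
            Set (Matrix (Fin d) (Fin d) ℝ)),
          Commute P Q := by
  let S := Algebra.adjoin ℝ ({C, H} : Set (Matrix (Fin d) (Fin d) ℝ))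
  have hC : C ∈ S := Algebra.subset_adjoin (by simp)
  have hH : H ∈ S := Algebra.subset_adjoin (by simp)
  have hS : ∀ P ∈ S, ∀ Q ∈ S, Commute P Q := by
    have hc : ∀ x ∈ ({C, H} : Set (Matrix (Fin d) (Fin d) ℝ)),
        ∀ y ∈ ({C, H} : Set (Matrix (Fin d) (Fin d) ℝ)), x * y = y * x := by
      rintro x (rfl | rfl) y (rfl | rfl)
      · rfl
      · exact hcomm
      · exact hcomm.symm
      · rfl
    have hle := Algebra.adjoin_le_centralizer_centralizer ℝ
      ({C, H} : Set (Matrix (Fin d) (Fin d) ℝ))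
    intro P hP Q hQ
    exact Set.centralizer_centralizer_comm_of_comm hc _ (hle hP) _ (hle hQ)
  have hρb : ∀ m, |η ^ 2 * ρ m| ≤ η ^ 2 * 2 := by
    intro m
    have hM' : (2 : ℝ) ≤ M := by exact_mod_cast hM
    rw [abs_mul, abs_of_nonneg (sq_nonneg η)]
    refine mul_le_mul_of_nonneg_left ?_ (sq_nonneg η)
    rw [hρ]
    refine (abs_sub _ _).trans ?_
    have h1 : |if m = 0 then (1 : ℝ) else 0| ≤ 1 := by split_ifs <;> simp
    have h2 : |if 1 ≤ |m| ∧ |m| ≤ (M : ℤ) then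
        ((M : ℝ) - ((|m| : ℤ) : ℝ)) / ((M : ℝ) * ((M : ℝ) - 1)) else 0| ≤ 1 := by
      split_ifs with hm
      · have a1 : (1 : ℝ) ≤ ((|m| : ℤ) : ℝ) := by exact_mod_cast hm.1
        have a2 : ((|m| : ℤ) : ℝ) ≤ M := by exact_mod_cast hm.2
        have a3 : (0 : ℝ) < (M : ℝ) * ((M : ℝ) - 1) := by nlinarith
        rw [abs_of_nonneg (div_nonneg (by linarith) a3.le), div_le_one a3]
        nlinarith
      · simp
    linarith
  have hsum := hb_summable η β hη hβ0 hβ1 H hHs heig X hX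
  obtain ⟨Y, hY⟩ := hb_hasSum X (Matrix.fromBlocks C C C C) (fun m => η ^ 2 * ρ m) _ hρb hsum
  simp only [← hZ] at hY
  refine ⟨Y, hY, ?_⟩
  have hXS : X ∈ blocksIn S := by
    subst hX
    exact ⟨S.sub_mem S.one_mem (S.smul_mem hH _), S.smul_mem S.one_mem _,
      S.neg_mem (S.smul_mem hH _), S.smul_mem S.one_mem _⟩
  have hXtS : Xᵀ ∈ blocksIn S := by
    have hHt : Hᵀ = H := by simpa [Matrix.IsHermitian, Matrix.conjTranspose_eq_transpose_of_trivial] using hHs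
    rw [hX, Matrix.fromBlocks_transpose]
    simp only [Matrix.transpose_sub, Matrix.transpose_neg, Matrix.transpose_smul,
      Matrix.transpose_one, hHt]
    exact ⟨S.sub_mem S.one_mem (S.smul_mem hH _), S.neg_mem (S.smul_mem hH _),
      S.smul_mem S.one_mem _, S.smul_mem S.one_mem _⟩
  have hZS : ∀ m, Z m ∈ blocksIn S := by
    intro m
    rw [hZ]
    have hCC : Matrix.fromBlocks C C C C ∈ blocksIn S := ⟨hC, hC, hC, hC⟩
    exact (blocksIn S).smul_mem hCC _
  have hcl : IsClosed ((blocksIn S : Subalgebra ℝ _) :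
      Set (Matrix (Fin d ⊕ Fin d) (Fin d ⊕ Fin d) ℝ)) :=
    (Subalgebra.toSubmodule (blocksIn S)).closed_of_finiteDimensional
  have hYS : Y ∈ blocksIn S := by
    refine hcl.mem_of_tendsto hY (Eventually.of_forall fun h => ?_)
    exact Subalgebra.sum_mem _ fun i _ => Subalgebra.sum_mem _ fun j _ =>
      (blocksIn S).mul_mem ((blocksIn S).mul_mem ((blocksIn S).pow_mem hXS _) (hZS _))
        ((blocksIn S).pow_mem hXtS _)
  obtain ⟨y1, y2, y3, y4⟩ := hYS
  have hall : ∀ P ∈ ({Y.toBlocks₁₁, Y.toBlocks₁₂, Y.toBlocks₂₁, Y.toBlocks₂₂} :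
      Set (Matrix (Fin d) (Fin d) ℝ)), P ∈ S := by
    rintro P (rfl | rfl | rfl | rfl)
    exacts [y1, y2, y3, y4]
  intro P hP
  exact ⟨hS _ (hall P hP) _ hC, hS _ (hall P hP) _ hH,
    fun Q hQ => hS _ (hall P hP) _ (hall Q hQ)⟩
end
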